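/- Let d ≥ 2, p₀ > d, 𝔇 = (p₀ − d)/(p₀ − 1) (so p₀ = (d−𝔇)/(1−𝔇)), λ = 2^{−1/𝔇}, γ ∈ ℝ, and let u and b be the superdimensional competitor and auxiliary function on Ω = (−1,1)^d. Let α > 0, 1 < p < q < ∞, let ρ_a ∈ C^∞(ℝ^d \ ({0}^{d−1} × 𝔠_{λ,γ})) satisfy 1_{{dist(x_d, 𝔠_{λ,γ}) ≤ |x̄|/2}} ≤ ρ_a ≤ 1_{{dist(x_d, 𝔠_{λ,γ}) ≤ 2|x̄|}} and |∇ρ_a| ≤ C|x̄|^{−1} 1_{{|x̄|/2 ≤ dist(x_d, 𝔠_{λ,γ}) ≤ 2|x̄|}}, and define a(x) = |x̄|^α (1 − ρ_a(x)), φ(x,t) = t^p/p + a(x) t^q/q, F(w) = ∫_Ω φ(x, |∇w|) dx, F*(f) = ∫_Ω φ*(x, |f|) dx with φ*(x,s) = sup_{t≥0}(st − φ(x,t)). If q > p₀ + α (p₀−1)/(d−1), and either p < p₀, or p = p₀ and γ𝔇(p₀−1) > 1, then F(u) < ∞, F*(b) < ∞, and for every κ > 0 there exist η, s > 0 such that F(η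 u) + F*(s b) < κ η s. -/

import Mathlib

open MeasureTheory Real Set Metric Filter Topology NNReal ENNReal

noncomputable section

/-- `ℝ^n` with the Euclidean structure. -/
abbrev Euc (n : ℕ) := EuclideanSpace ℝ (Fin n)

/-- The open cube `(-1,1)^n`. -/
def Box (n : ℕ) : Set (Euc n) := {x | ∀ i, |x i| < 1}

/-- The last coordinate `x_d` of `x ∈ ℝ^{n+1}`. -/
def lastC {n : ℕ} (x : Euc (n + 1)) : ℝ := x (Fin.last n)

/-- The first `n` coordinates `x̄` of `x ∈ ℝ^{n+1}`. -/
def frontC {n : ℕ} (x : Euc (n + 1)) : Euc n := WithLp.toLp 2 fun i => x i.castSucc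

/-- Assemble a point of `ℝ^{n+1}` from `x̄ ∈ ℝ^n` and a last coordinate. -/
def snocC {n : ℕ} (xb : Euc n) (t : ℝ) : Euc (n + 1) :=
  WithLp.toLp 2 (Fin.snoc (α := fun _ => ℝ) (fun i => xb i) t)

/-- The first `m` coordinates of `x ∈ ℝ^{m+k}`. -/
def barPart {m k : ℕ} (x : Euc (m + k)) : Euc m := WithLp.toLp 2 fun i => x (Fin.castAdd k i)

/-- The last `k` coordinates of `x ∈ ℝ^{m+k}`. -/
def hatPart {m k : ℕ} (x : Euc (m + k)) : Euc k := WithLp.toLp 2 fun i => x (Fin.natAdd m i)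

/-- Admissibility of a sequence of interval lengths for the generalized `(λ,γ)`-Cantor set:
`l 0 = 1`, the lengths decrease fast enough (`l_{j-1} > 2 l_j`, removed gaps decreasing), and
`l j` is comparable to `λ^j j^γ`. -/
def IsCantorLengths (lam gam : ℝ) (l : ℕ → ℝ) : Prop :=
  l 0 = 1 ∧ (∀ j, 0 < l j) ∧ (∀ j, 2 * l (j + 1) < l j) ∧
    (∀ j, l (j + 1) - 2 * l (j + 2) < l j - 2 * l (j + 1)) ∧
    ∃ C : ℝ, 1 ≤ C ∧ ∀ j : ℕ, 1 ≤ j →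
      C⁻¹ * lam ^ j * (j : ℝ) ^ gam ≤ l j ∧ l j ≤ C * lam ^ j * (j : ℝ) ^ gam

/-- The point of the generalized Cantor set with address `ε` (left endpoints of the nested
intervals converge to this point). -/
def gCantorPoint (l : ℕ → ℝ) (ε : ℕ → Bool) : ℝ :=
  -(1 / 2 : ℝ) + ∑' j : ℕ, if ε j then l j - l (j + 1) else 0

/-- The generalized Cantor set determined by the lengths `l`. -/
def gCantorSet (l : ℕ → ℝ) : Set ℝ := Set.range (gCantorPoint l)

/-- The `m`-fold Cartesian power of the generalized Cantor set, inside `ℝ^m`. -/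
def gCantorSetPi (l : ℕ → ℝ) (m : ℕ) : Set (Euc m) := {x | ∀ i, x i ∈ gCantorSet l}

/-- The `j`-th binary digit of `t`. -/
def binDigit (t : ℝ) (j : ℕ) : Bool := ⌊t * 2 ^ (j + 1)⌋ % 2 = 1

/-- The Cantor measure attached to the lengths `l`: the image of the uniform distribution on
`[0,1)` under the map sending `t` to the Cantor point whose address is the binary digit
sequence of `t` (the digits being i.i.d. fair coins, this is the weak limit of the uniform
distributions on the pre-Cantor sets). -/
def gCantorMeasure (l : ℕ → ℝ) : Measure ℝ :=
  Measure.map (fun t => gCantorPoint l (binDigit t)) (volume.restrict (Set.Ico (0 : ℝ) 1))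

/-- The `m`-fold product of the Cantor measure, as a measure on `ℝ^m`. -/
def gCantorMeasurePi (l : ℕ → ℝ) (m : ℕ) : Measure (Euc m) :=
  Measure.map (⇑(MeasurableEquiv.toLp 2 (Fin m → ℝ)))
    (Measure.pi fun _ : Fin m => gCantorMeasure l)

/-- The fractal dimension `𝔇 = m log 2 / log(1/λ)`. -/
def frD (m : ℕ) (lam : ℝ) : ℝ := m * Real.log 2 / Real.log lam⁻¹

/-- `G` is the weak (distributional) differential of `u` on `Ω`:
integration by parts against smooth compactly supported test functions holds. -/
def HasWeakFDerivOn {n : ℕ} (Ω : Set (Euc n)) (u : Euc n → ℝ)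
    (G : Euc n → Euc n →L[ℝ] ℝ) : Prop :=
  ∀ φ : Euc n → ℝ, ContDiff ℝ (⊤ : ℕ∞) φ → HasCompactSupport φ → tsupport φ ⊆ Ω →
    ∫ x in Ω, u x • fderiv ℝ φ x = -∫ x in Ω, φ x • G x

/-- `u ∈ W^{1,1}(Ω)` with weak differential `G`. -/
def W11On {n : ℕ} (Ω : Set (Euc n)) (u : Euc n → ℝ) (G : Euc n → Euc n →L[ℝ] ℝ) : Prop :=
  IntegrableOn u Ω ∧ IntegrableOn G Ω ∧ HasWeakFDerivOn Ω u G

/-- `w ∈ W^{1,1}_0(Ω)` (with weak differential `G`): the extensions by zero form a Sobolev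
function on all of `ℝ^n`. -/
def ZeroBoundary {n : ℕ} (Ω : Set (Euc n)) (w : Euc n → ℝ)
    (G : Euc n → Euc n →L[ℝ] ℝ) : Prop :=
  Integrable (Set.indicator Ω w) ∧ Integrable (Set.indicator Ω G) ∧
    HasWeakFDerivOn Set.univ (Set.indicator Ω w) (Set.indicator Ω G)

/-- The energy `∫_Ω φ(x, g x) dx` for a scalar field `g` (typically `g = |∇w|`). -/
def energyOf {n : ℕ} (Ω : Set (Euc n)) (φ : Euc n → ℝ → ℝ) (g : Euc n → ℝ) : ℝ≥0∞ :=
  ∫⁻ x in Ω, ENNReal.ofReal (φ x (g x))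

/-- The Young (Legendre–Fenchel) conjugate `φ*(s) = sup_{t ≥ 0} (s t − φ(t))`. -/
def conjOrlicz (φ : ℝ → ℝ) (s : ℝ) : ℝ≥0∞ :=
  ⨆ t : ℝ≥0, ENNReal.ofReal (s * t - φ t)

/-- The conjugate energy `∫_Ω φ*(x, g x) dx`. -/
def energyConj {n : ℕ} (Ω : Set (Euc n)) (φ : Euc n → ℝ → ℝ) (g : Euc n → ℝ) : ℝ≥0∞ :=
  ∫⁻ x in Ω, conjOrlicz (φ x) (g x)

/-- `u` (with weak differential `G`, finite energy) is a local minimizer of the functional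
`w ↦ ∫_Ω φ(x,|∇w|) dx`: its energy does not exceed that of any Sobolev competitor that agrees
with `u` a.e. outside a compact subset of `Ω`. -/
def IsLocalMinimizer {n : ℕ} (Ω : Set (Euc n)) (φ : Euc n → ℝ → ℝ) (u : Euc n → ℝ)
    (G : Euc n → Euc n →L[ℝ] ℝ) : Prop :=
  W11On Ω u G ∧ energyOf Ω φ (fun x => ‖G x‖) < ⊤ ∧
    ∀ v Gv, W11On Ω v Gv →
      (∃ K : Set (Euc n), IsCompact K ∧ K ⊆ Ω ∧ ∀ᵐ x ∂(volume.restrict Ω), x ∉ K → v x = u x) →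
      energyOf Ω φ (fun x => ‖G x‖) ≤ energyOf Ω φ (fun x => ‖Gv x‖)

/-- `x` is a non-Lebesgue point of `u`: the averages of `|u − c|` on small balls around `x`
do not converge to `0` for any constant `c`. -/
def IsNonLebesguePoint {n : ℕ} (u : Euc n → ℝ) (x : Euc n) : Prop :=
  ¬ ∃ c : ℝ, Tendsto (fun r : ℝ => ⨍ y in Metric.ball x r, |u y - c| ∂volume)
      (𝓝[>] (0 : ℝ)) (𝓝 0)

/-- Membership in the Hölder class `C^α` on `s` (for `α ≥ 1` interpreted via
`C^{⌊α⌋, α − ⌊α⌋}`). -/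
def InHolderCls {n : ℕ} (α : ℝ) (s : Set (Euc n)) (a : Euc n → ℝ) : Prop :=
  ContDiffOn ℝ (⌊α⌋₊ : ℕ) a s ∧
    ∃ C : ℝ≥0, HolderOnWith C (Real.toNNReal (α - ⌊α⌋₊))
      (fun x => iteratedFDerivWithin ℝ ⌊α⌋₊ a s x) s

/-- The restricted Riesz potential `I₁^⋈(|f|)(x̄,0) = ∫_{C((x̄,0))} |f(y)| |x−y|^{1−d} dy`,
where `C(x)` is the double cone `{y : |ȳ − x̄| ≤ |y_d − x_d|/2}` (here `d = n+1`). -/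
def rieszBow {n : ℕ} (f : Euc (n + 1) → ℝ) (xb : Euc n) : ℝ≥0∞ :=
  ∫⁻ y : Euc (n + 1),
    ENNReal.ofReal ((if dist (frontC y) xb ≤ |lastC y| / 2 then (1 : ℝ) else 0) *
      |f y| * Real.sqrt (dist (frontC y) xb ^ 2 + lastC y ^ 2) ^ (-(n : ℝ)))

/-- The upper average `⟨f⟩⁺_{x̄,r} = ∫_{B_1} ω(y) f(x̄ + |r| ȳ, |r| y_d + |r|) dy`. -/
def avgPlus {n : ℕ} (ω : Euc (n + 1) → ℝ) (f : Euc (n + 1) → ℝ) (xb : Euc n) (r : ℝ) : ℝ :=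
  ∫ y in Metric.ball (0 : Euc (n + 1)) 1,
    ω y * f (snocC (xb + |r| • frontC y) (|r| * lastC y + |r|))

/-- The lower average `⟨f⟩⁻_{x̄,r} = ∫_{B_1} ω(y) f(x̄ + |r| ȳ, |r| y_d − |r|) dy`. -/
def avgMinus {n : ℕ} (ω : Euc (n + 1) → ℝ) (f : Euc (n + 1) → ℝ) (xb : Euc n) (r : ℝ) : ℝ :=
  ∫ y in Metric.ball (0 : Euc (n + 1)) 1,
    ω y * f (snocC (xb + |r| • frontC y) (|r| * lastC y - |r|))

open Classical in
/-- The function `u_d(x) = (1/2) sgn(x_d) θ(|x_d|/|x̄|)` (extended by its natural limit value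
`(1/2) sgn(x_d)` on the line `x̄ = 0`). -/
def uD {n : ℕ} (θ : ℝ → ℝ) (x : Euc (n + 1)) : ℝ :=
  if frontC x = 0 then (1 / 2) * Real.sign (lastC x)
  else (1 / 2) * Real.sign (lastC x) * θ (|lastC x| / ‖frontC x‖)

/-- Hypotheses on the profile function `θ`:
smooth on `(0,∞)`, `1_{(1/2,∞)} ≤ θ ≤ 1_{(1/4,∞)}` and `‖θ'‖_∞ ≤ 6`. -/
def IsProfile (θ : ℝ → ℝ) : Prop :=
  ContDiffOn ℝ (⊤ : ℕ∞) θ (Set.Ioi 0) ∧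
    (∀ t : ℝ, 0 < t → (if 1 / 2 < t then (1 : ℝ) else 0) ≤ θ t) ∧
    (∀ t : ℝ, 0 < t → θ t ≤ if 1 / 4 < t then 1 else 0) ∧
    (∀ t : ℝ, 0 < t → |deriv θ t| ≤ 6)

end

section helpers

lemma cl_sumle (l : ℕ → ℝ) (h0 : ∀ j, 0 < l j) (h2 : ∀ j, 2 * l (j + 1) < l j)
    (ε : ℕ → Bool) (j N : ℕ) :
    (∑ i ∈ Finset.range (j + N), if ε i then l i - l (i + 1) else 0) ≤
      (∑ i ∈ Finset.range j, if ε i then l i - l (i + 1) else 0) + l j - l (j + N) := by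
  induction N with
  | zero => simp
  | succ N ih =>
    rw [← add_assoc, Finset.sum_range_succ]
    have a1 := h0 (j + N + 1)
    have a2 := h2 (j + N)
    split_ifs <;> linarith

lemma cl_nonneg (l : ℕ → ℝ) (h0 : ∀ j, 0 < l j) (h2 : ∀ j, 2 * l (j + 1) < l j)
    (ε : ℕ → Bool) (i : ℕ) : 0 ≤ (if ε i then l i - l (i + 1) else 0) := by
  have a1 := h0 (i + 1)
  have a2 := h2 i
  split_ifs <;> linarith

lemma cl_bounds (l : ℕ → ℝ) (h0 : ∀ j, 0 < l j) (h2 : ∀ j, 2 * l (j + 1) < l j)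
    (ε : ℕ → Bool) (j : ℕ) :
    -(1/2 : ℝ) + (∑ i ∈ Finset.range j, if ε i then l i - l (i + 1) else 0) ≤ gCantorPoint l ε ∧
    gCantorPoint l ε ≤
      -(1/2 : ℝ) + (∑ i ∈ Finset.range j, if ε i then l i - l (i + 1) else 0) + l j := by
  have hnn := cl_nonneg l h0 h2 ε
  have hs : Summable (fun i => if ε i then l i - l (i + 1) else 0) := by
    refine summable_of_sum_range_le (c := l 0) hnn ?_
    intro N
    have := cl_sumle l h0 h2 ε 0 N
    have h := h0 (0 + N)
    simp only [zero_add, Finset.range_zero, Finset.sum_empty] at this h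
    linarith
  unfold gCantorPoint
  constructor
  · have := hs.sum_le_tsum (Finset.range j) (fun i _ => hnn i)
    linarith
  · have : (∑' i, if ε i then l i - l (i + 1) else 0) ≤
      (∑ i ∈ Finset.range j, if ε i then l i - l (i + 1) else 0) + l j := by
      refine Real.tsum_le_of_sum_range_le hnn ?_
      intro N
      have h1 := cl_sumle l h0 h2 ε j N
      have h3 := h0 (j + N)
      have h4 : (∑ i ∈ Finset.range N, if ε i then l i - l (i + 1) else 0) ≤
        (∑ i ∈ Finset.range (j + N), if ε i then l i - l (i + 1) else 0) :=
        Finset.sum_le_sum_of_subset_of_nonneg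
          (Finset.range_mono (by omega)) (fun i _ _ => hnn i)
      linarith
    linarith

lemma floor_digit (t : ℝ) (j : ℕ) :
    ⌊t * 2 ^ (j + 1)⌋ = 2 * ⌊t * 2 ^ j⌋ + (if binDigit t j then 1 else 0) := by
  have h1 : (⌊t * 2 ^ (j + 1)⌋ : ℤ) / 2 = ⌊t * 2 ^ j⌋ := by
    have := Int.floor_div_natCast (t * 2 ^ (j + 1)) 2
    rw [show t * 2 ^ (j + 1) / (2 : ℕ) = t * 2 ^ j by push_cast; rw [pow_succ]; ring] at this
    rw [this]; norm_num
  unfold binDigit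
  simp only [decide_eq_true_eq]
  split_ifs <;> omega

lemma A_mono (l : ℕ → ℝ) (h2 : ∀ j, 2 * l (j + 1) < l j)
    (t t' : ℝ) (ht : t ∈ Ico (0:ℝ) 1) (ht' : t' ∈ Ico (0:ℝ) 1) (h : t ≤ t') (j : ℕ) :
    ((⌊t' * 2 ^ j⌋ : ℝ) - ⌊t * 2 ^ j⌋) * l j ≤
      (∑ i ∈ Finset.range j, if binDigit t' i then l i - l (i + 1) else 0) -
      (∑ i ∈ Finset.range j, if binDigit t i then l i - l (i + 1) else 0) := by
  induction j with
  | zero =>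
    have e1 : ⌊t⌋ = 0 := Int.floor_eq_zero_iff.2 ht
    have e2 : ⌊t'⌋ = 0 := Int.floor_eq_zero_iff.2 ht'
    simp [e1, e2]
  | succ j ih =>
    have hm : ⌊t * 2 ^ (j + 1)⌋ ≤ ⌊t' * 2 ^ (j + 1)⌋ := Int.floor_mono (by gcongr)
    rw [Finset.sum_range_succ, Finset.sum_range_succ]
    have g := h2 j
    rw [floor_digit t j, floor_digit t' j] at hm ⊢
    set k := ⌊t * 2 ^ j⌋
    set k' := ⌊t' * 2 ^ j⌋
    by_cases c1 : binDigit t j <;> by_cases c2 : binDigit t' j <;> simp only [c1, c2] at hm ⊢ <;>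
      push_cast
    · have : (k:ℝ) ≤ k' := by exact_mod_cast (by simp at hm; omega : k ≤ k')
      simp; nlinarith
    · have : (k:ℝ) + 1 ≤ k' := by exact_mod_cast (by simp at hm; omega : k + 1 ≤ k')
      simp; nlinarith
    · have : (k:ℝ) ≤ k' := by exact_mod_cast (by simp at hm; omega : k ≤ k')
      simp; nlinarith
    · have : (k:ℝ) ≤ k' := by exact_mod_cast (by simp at hm; omega : k ≤ k')
      simp; nlinarith

lemma X_lower (l : ℕ → ℝ) (h0 : ∀ j, 0 < l j) (h2 : ∀ j, 2 * l (j + 1) < l j)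
    (t t' : ℝ) (ht : t ∈ Ico (0:ℝ) 1) (ht' : t' ∈ Ico (0:ℝ) 1) (h : t ≤ t') (j : ℕ) :
    (2 ^ j * (t' - t) - 2) * l j ≤
      gCantorPoint l (binDigit t') - gCantorPoint l (binDigit t) := by
  have a1 := (cl_bounds l h0 h2 (binDigit t') j).1
  have a2 := (cl_bounds l h0 h2 (binDigit t) j).2
  have a3 := A_mono l h2 t t' ht ht' h j
  have a4 := Int.lt_floor_add_one (t' * 2 ^ j)
  have a5 := Int.floor_le (t * 2 ^ j)
  have a6 : (2 ^ j * (t' - t) - 2) * l j ≤ ((⌊t' * 2 ^ j⌋ : ℝ) - ⌊t * 2 ^ j⌋ - 1) * l j := by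
    refine mul_le_mul_of_nonneg_right ?_ (h0 j).le
    linarith
  linarith

lemma X_mono (l : ℕ → ℝ) (h0 : ∀ j, 0 < l j) (h2 : ∀ j, 2 * l (j + 1) < l j) :
    MonotoneOn (fun t => gCantorPoint l (binDigit t)) (Ico (0:ℝ) 1) := by
  intro t ht t' ht' h
  rcases h.eq_or_lt with h | h
  · rw [h]
  obtain ⟨j, hj⟩ := pow_unbounded_of_one_lt (2 / (t' - t)) (one_lt_two)
  have h3 : 0 < t' - t := by linarith
  rw [div_lt_iff₀ h3] at hj
  have := X_lower l h0 h2 t t' ht ht' h.le j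
  have h4 := h0 j
  simp only
  nlinarith

lemma vol_E (l : ℕ → ℝ) (h0 : ∀ j, 0 < l j) (h2 : ∀ j, 2 * l (j + 1) < l j)
    (s r : ℝ) (j : ℕ) (hr : r ≤ l j) :
    volume {t : ℝ | t ∈ Ico (0:ℝ) 1 ∧ |s - gCantorPoint l (binDigit t)| ≤ r} ≤
      ENNReal.ofReal (4 * (1/2) ^ j) := by
  refine (Real.volume_le_diam _).trans ?_
  refine Metric.ediam_le ?_
  have key : ∀ t t' : ℝ, t ∈ Ico (0:ℝ) 1 → |s - gCantorPoint l (binDigit t)| ≤ r →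
     t' ∈ Ico (0:ℝ) 1 → |s - gCantorPoint l (binDigit t')| ≤ r → t ≤ t' →
      t' - t ≤ 4 * (1/2) ^ j := by
    intro t t' ht hx ht' hx' h
    have := X_lower l h0 h2 t t' ht ht' h j
    have b1 := abs_le.1 hx
    have b2 := abs_le.1 hx'
    have h4 := h0 j
    have h5 : 2 ^ j * (t' - t) ≤ 4 := by
      by_contra hc
      push Not at hc
      nlinarith
    rw [div_pow, one_pow, mul_one_div, le_div_iff₀ (by positivity)]
    linarith
  rintro t ⟨ht, hx⟩ t' ⟨ht', hx'⟩
  rw [edist_dist]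
  refine ENNReal.ofReal_le_ofReal ?_
  rw [Real.dist_eq]
  rcases le_total t t' with h | h
  · rw [abs_sub_comm, abs_of_nonneg (by linarith)]
    exact key t t' ht hx ht' hx' h
  · rw [abs_of_nonneg (by linarith)]
    exact key t' t ht' hx' ht hx h

lemma cover (l : ℕ → ℝ) (h0 : ∀ j, 0 < l j) (h2 : ∀ j, 2 * l (j + 1) < l j) (j : ℕ) :
    ∃ E : Set ℝ, MeasurableSet E ∧ volume E ≤ ENNReal.ofReal (11 * l j * 2 ^ j) ∧
      ∀ s : ℝ, infDist s (gCantorSet l) ≤ 4 * l j → s ∈ E := by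
  classical
  let A : (Fin j → Bool) → ℝ := fun e => -(1/2) + ∑ i : Fin j, if e i then l i - l (i + 1) else 0
  refine ⟨⋃ e : Fin j → Bool, Icc (A e - 5 * l j) (A e + 6 * l j),
    MeasurableSet.iUnion fun e => measurableSet_Icc, ?_, ?_⟩
  · refine (measure_iUnion_le _).trans ?_
    simp only [Real.volume_Icc]
    rw [tsum_fintype]
    simp only [show ∀ e, A e + 6 * l j - (A e - 5 * l j) = 11 * l j from fun e => by ring]
    simp only [Finset.sum_const, Finset.card_univ, Fintype.card_pi, Fintype.card_bool,
      Finset.prod_const, Fintype.card_fin, nsmul_eq_mul]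
    rw [ENNReal.ofReal_mul (p := 11 * l j) (by have := h0 j; positivity),
      ENNReal.ofReal_pow (by norm_num)]
    simp [mul_comm]
  · intro s hs
    have hl := h0 j
    have hne : (gCantorSet l).Nonempty := Set.range_nonempty _
    obtain ⟨y, ⟨ε, rfl⟩, hy⟩ := (Metric.infDist_lt_iff hne).1 (show infDist s (gCantorSet l) < 5 * l j by linarith)
    rw [mem_iUnion]
    refine ⟨fun i => ε i, ?_⟩
    have hb := cl_bounds l h0 h2 ε j
    rw [Finset.sum_range] at hb
    rw [Real.dist_eq, abs_lt] at hy
    constructor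
    · simp only [A]; linarith [hb.1]
    · simp only [A]; linarith [hb.2]

end helpers

section helpers2

def cylS (n : ℕ) (r : ℝ) (E : Set ℝ) : Set (Euc (n + 1)) :=
  {x | (∀ i : Fin n, |x i.castSucc| ≤ r) ∧ x (Fin.last n) ∈ E}

lemma cylS_eq (n : ℕ) (r : ℝ) (E : Set ℝ) :
    cylS n r E = (@WithLp.ofLp 2 (Fin (n + 1) → ℝ)) ⁻¹'
      (Set.univ.pi (Fin.snoc (α := fun _ => Set ℝ) (fun _ : Fin n => Icc (-r) r) E)) := by
  ext x
  simp only [cylS, Set.mem_ofPred_eq, mem_preimage, Set.mem_pi, mem_univ, true_implies]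
  rw [Fin.forall_fin_succ']
  simp [abs_le]

lemma cylS_meas (n : ℕ) (r : ℝ) (E : Set ℝ) (hE : MeasurableSet E) :
    MeasurableSet (cylS n r E) := by
  rw [cylS_eq]
  refine (PiLp.volume_preserving_ofLp (Fin (n+1))).measurable ?_
  refine MeasurableSet.univ_pi ?_
  intro i
  refine Fin.lastCases ?_ (fun i => ?_) i
  · simpa using hE
  · simp

lemma cylS_vol (n : ℕ) (r : ℝ) (E : Set ℝ) (hE : MeasurableSet E) :
    volume (cylS n r E) = ENNReal.ofReal (2 * r) ^ n * volume E := by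
  have hm := cylS_meas n r E hE
  rw [cylS_eq] at hm ⊢
  rw [(PiLp.volume_preserving_ofLp (Fin (n+1))).measure_preimage]
  · rw [volume_pi_pi, Fin.prod_univ_castSucc]
    simp [Real.volume_Icc, two_mul]
  · refine (MeasurableSet.univ_pi ?_).nullMeasurableSet
    intro i
    refine Fin.lastCases ?_ (fun i => ?_) i
    · simpa using hE
    · simp

lemma front_coord {n : ℕ} (x : Euc (n + 1)) (i : Fin n) : |x i.castSucc| ≤ ‖frontC x‖ := by
  have := PiLp.norm_apply_le (frontC x) i
  simpa [frontC] using this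

lemma l_small (l : ℕ → ℝ) (h00 : l 0 = 1) (h2 : ∀ j, 2 * l (j + 1) < l j) (j : ℕ) :
    l j ≤ (1/2) ^ j := by
  induction j with
  | zero => simp [h00]
  | succ j ih => rw [pow_succ]; linarith [h2 j]

lemma shell_exists (l : ℕ → ℝ) (h00 : l 0 = 1) (h2 : ∀ j, 2 * l (j + 1) < l j)
    (r : ℝ) (hr : 0 < r) (hr1 : r < 1) : ∃ j, l (j + 1) ≤ r ∧ r < l j := by
  classical
  have hex : ∃ j, l j ≤ r := by
    obtain ⟨j, hj⟩ := exists_pow_lt_of_lt_one hr (show (1/2 : ℝ) < 1 by norm_num)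
    exact ⟨j, (l_small l h00 h2 j).trans hj.le⟩
  have hf := Nat.find_spec hex
  have hpos : Nat.find hex ≠ 0 := by
    intro h0
    rw [h0, h00] at hf
    linarith
  obtain ⟨k, hk⟩ := Nat.exists_eq_succ_of_ne_zero hpos
  refine ⟨k, ?_, ?_⟩
  · rw [hk] at hf; exact hf
  · have := Nat.find_min hex (m := k) (by omega)
    push Not at this
    exact this

lemma front_null {n : ℕ} (hn : 1 ≤ n) : ∀ᵐ x : Euc (n + 1), 0 < ‖frontC x‖ := by
  have h : volume (cylS n 0 Set.univ) = 0 := by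
    rw [cylS_vol _ _ _ MeasurableSet.univ]
    simp [show n ≠ 0 by omega]
  refine measure_mono_null ?_ h
  intro x hx
  simp only [mem_compl_iff, Set.mem_ofPred_eq, not_lt] at hx
  refine ⟨fun i => (front_coord x i).trans hx, trivial⟩

lemma shell_bound {n : ℕ} (hn : 1 ≤ n) (l : ℕ → ℝ) (h00 : l 0 = 1) (h0 : ∀ j, 0 < l j)
    (h2 : ∀ j, 2 * l (j + 1) < l j) (f : Euc (n + 1) → ℝ≥0∞) (K : ℝ≥0∞) (hK : K ≠ ⊤)
    (c : ℕ → ℝ) (hc : ∀ j, 0 ≤ c j)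
    (H1 : ∀ x, 1 ≤ ‖frontC x‖ → f x ≤ K)
    (H2 : ∀ x j, l (j + 1) ≤ ‖frontC x‖ → ‖frontC x‖ < l j →
      infDist (lastC x) (gCantorSet l) ≤ 4 * ‖frontC x‖ → f x ≤ ENNReal.ofReal (c j))
    (H3 : ∀ x, 0 < ‖frontC x‖ → 4 * ‖frontC x‖ < infDist (lastC x) (gCantorSet l) → f x = 0)
    (hs : Summable fun j => c j * l j ^ (n + 1) * 2 ^ j) :
    ∫⁻ x in Box (n + 1), f x < ⊤ := by
  choose E hE1 hE2 hE3 using cover l h0 h2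
  have hbox : Box (n + 1) ⊆ cylS n 1 (Icc (-1) 1) := by
    intro x hx
    refine ⟨fun i => (hx _).le, abs_le.1 (hx _).le⟩
  have hvb : volume (cylS n 1 (Icc (-1) 1)) ≠ ⊤ := by
    rw [cylS_vol _ _ _ measurableSet_Icc]
    refine ENNReal.mul_ne_top (ENNReal.pow_ne_top ENNReal.ofReal_ne_top) ?_
    rw [Real.volume_Icc]; exact ENNReal.ofReal_ne_top
  calc ∫⁻ x in Box (n + 1), f x ≤ ∫⁻ x in cylS n 1 (Icc (-1) 1), f x :=
        lintegral_mono_set hbox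
    _ ≤ ∫⁻ x in cylS n 1 (Icc (-1) 1),
        (K + ∑' j, (cylS n (l j) (E j)).indicator (fun _ => ENNReal.ofReal (c j)) x) := by
        refine lintegral_mono_ae ?_
        refine ae_restrict_of_ae ?_
        filter_upwards [front_null hn] with x hx
        by_cases hx1 : 1 ≤ ‖frontC x‖
        · exact (H1 x hx1).trans le_self_add
        push Not at hx1
        by_cases hx2 : 4 * ‖frontC x‖ < infDist (lastC x) (gCantorSet l)
        · rw [H3 x hx hx2]; exact zero_le
        push Not at hx2
        obtain ⟨j, hj1, hj2⟩ := shell_exists l h00 h2 _ hx hx1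
        refine (H2 x j hj1 hj2 hx2).trans ?_
        refine le_trans ?_ (le_add_left (ENNReal.le_tsum j))
        rw [indicator_of_mem]
        refine ⟨fun i => (front_coord x i).trans hj2.le, hE3 j _ ?_⟩
        have : infDist (lastC x) (gCantorSet l) ≤ 4 * l j := by linarith
        exact this
    _ ≤ K * volume (cylS n 1 (Icc (-1) 1)) +
        ∫⁻ x, ∑' j, (cylS n (l j) (E j)).indicator (fun _ => ENNReal.ofReal (c j)) x := by
        rw [lintegral_add_left measurable_const, setLIntegral_const]
        gcongr
        exact Measure.restrict_le_self
    _ = K * volume (cylS n 1 (Icc (-1) 1)) +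
        ∑' j, ENNReal.ofReal (c j) * volume (cylS n (l j) (E j)) := by
        rw [lintegral_tsum]
        · congr 2
          ext j
          rw [lintegral_indicator_const (cylS_meas _ _ _ (hE1 j))]
        · intro j
          exact (measurable_const.indicator (cylS_meas _ _ _ (hE1 j))).aemeasurable
    _ ≤ K * volume (cylS n 1 (Icc (-1) 1)) +
        ∑' j, ENNReal.ofReal (2 ^ n * 11 * (c j * l j ^ (n + 1) * 2 ^ j)) := by
        gcongr with j
        rw [cylS_vol _ _ _ (hE1 j)]
        have hlj := h0 j
        have hcj := hc j
        calc _ ≤ ENNReal.ofReal (c j) * (ENNReal.ofReal (2 * l j) ^ n * ENNReal.ofReal (11 * l j * 2 ^ j)) := by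
              gcongr; exact hE2 j
          _ = _ := by
              rw [← ENNReal.ofReal_pow (by positivity), ← ENNReal.ofReal_mul (by positivity),
                ← ENNReal.ofReal_mul (by positivity)]
              congr 1; ring
    _ < ⊤ := by
        refine ENNReal.add_lt_top.2 ⟨(ENNReal.mul_ne_top hK hvb).lt_top, ?_⟩
        exact (hs.mul_left _).tsum_ofReal_lt_top

end helpers2

section helpers3

noncomputable def gP (θ : ℝ → ℝ) (s : ℝ) : ℝ := (1/2) * Real.sign s * θ |s|

lemma gP_small (θ : ℝ → ℝ) (hθ : IsProfile θ) (s : ℝ) (hs : |s| ≤ 1/4) : gP θ s = 0 := by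
  unfold gP
  by_cases h : s = 0
  · simp [h]
  have hp : 0 < |s| := abs_pos.2 h
  have h1 := hθ.2.1 _ hp
  have h2 := hθ.2.2.1 _ hp
  rw [if_neg (by linarith)] at h1
  rw [if_neg (by linarith)] at h2
  rw [le_antisymm h2 h1]; simp

lemma theta_big (θ : ℝ → ℝ) (hθ : IsProfile θ) (t : ℝ) (ht : 1/2 < t) : θ t = 1 := by
  have h1 := hθ.2.1 t (by linarith)
  have h2 := hθ.2.2.1 t (by linarith)
  rw [if_pos (by linarith)] at h1
  rw [if_pos (by linarith)] at h2
  exact le_antisymm h2 h1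

lemma gP_bound (θ : ℝ → ℝ) (hθ : IsProfile θ) (s : ℝ) : |gP θ s| ≤ 1 := by
  unfold gP
  by_cases h : s = 0
  · simp [h]
  have hp : 0 < |s| := abs_pos.2 h
  have h1 : 0 ≤ θ |s| := le_trans (by split_ifs <;> norm_num) (hθ.2.1 _ hp)
  have h2 : θ |s| ≤ 1 := (hθ.2.2.1 _ hp).trans (by split_ifs <;> norm_num)
  rw [abs_mul, abs_mul, abs_of_nonneg h1]
  have : |Real.sign s| ≤ 1 := by
    rcases Real.sign_apply_eq s with h | h | h <;> rw [h] <;> norm_num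
  rw [abs_of_pos (by norm_num : (0:ℝ) < 1/2)]
  nlinarith [abs_nonneg (Real.sign s)]

lemma gP_lip (θ : ℝ → ℝ) (hθ : IsProfile θ) : LipschitzWith 3 (gP θ) := by
  have key : ∀ s, ∃ g', HasDerivAt (gP θ) g' s ∧ |g'| ≤ 3 := by
    intro s
    have hd : ∀ t, 0 < t → HasDerivAt θ (deriv θ t) t := by
      intro t ht
      have : DifferentiableAt ℝ θ t :=
        (hθ.1.contDiffAt (Ioi_mem_nhds ht)).differentiableAt (by simp)
      exact this.hasDerivAt
    rcases lt_trichotomy s 0 with h | h | h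
    · refine ⟨(1/2) * deriv θ (-s), ?_, ?_⟩
      · have h1 : HasDerivAt (fun x => -(1/2) * θ (-x)) (-(1/2) * (deriv θ (-s) * (-1))) s := by
          refine HasDerivAt.const_mul _ ?_
          exact HasDerivAt.comp s (hd (-s) (by linarith)) (hasDerivAt_neg s)
        have h2 : gP θ =ᶠ[𝓝 s] (fun x => -(1/2) * θ (-x)) := by
          filter_upwards [Iio_mem_nhds h] with x hx
          rw [gP, Real.sign_of_neg hx, abs_of_neg hx]; ring
        convert! h1.congr_of_eventuallyEq h2 using 1; ring
      · rw [abs_mul]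
        have := hθ.2.2.2 (-s) (by linarith)
        rw [abs_of_pos (by norm_num : (0:ℝ) < 1/2)]; linarith
    · refine ⟨0, ?_, by simp⟩
      have h2 : gP θ =ᶠ[𝓝 s] (fun x => 0) := by
        filter_upwards [Metric.ball_mem_nhds s (show (0:ℝ) < 1/4 by norm_num)] with x hx
        rw [h] at hx
        simp only [Metric.mem_ball, dist_zero_right, Real.norm_eq_abs] at hx
        exact gP_small θ hθ x hx.le
      exact (hasDerivAt_const s (0:ℝ)).congr_of_eventuallyEq h2
    · refine ⟨(1/2) * deriv θ s, ?_, ?_⟩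
      · have h1 : HasDerivAt (fun x => (1/2) * θ x) ((1/2) * (deriv θ s)) s :=
          HasDerivAt.const_mul _ (hd s h)
        have h2 : gP θ =ᶠ[𝓝 s] (fun x => (1/2) * θ x) := by
          filter_upwards [Ioi_mem_nhds h] with x hx
          rw [gP, Real.sign_of_pos hx, abs_of_pos hx]; ring
        exact h1.congr_of_eventuallyEq h2
      · rw [abs_mul]
        have := hθ.2.2.2 s (by linarith)
        rw [abs_of_pos (by norm_num : (0:ℝ) < 1/2)]; linarith
  refine lipschitzWith_of_nnnorm_deriv_le (fun s => ?_) (fun s => ?_)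
  · obtain ⟨g', h, _⟩ := key s
    exact h.differentiableAt
  · obtain ⟨g', h, hb⟩ := key s
    rw [h.deriv, ← NNReal.coe_le_coe]
    simpa using hb

lemma gP_dist (θ : ℝ → ℝ) (hθ : IsProfile θ) (s t : ℝ) : |gP θ s - gP θ t| ≤ 3 * |s - t| := by
  have := (gP_lip θ hθ).dist_le_mul s t
  simpa [Real.dist_eq] using this

/-- equality of the profile at two far away points of the same sign -/
lemma gP_far (θ : ℝ → ℝ) (hθ : IsProfile θ) (y y0 r r0 : ℝ) (hr : 0 < r) (hr0 : 0 < r0)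
    (h1 : r / 2 < |y|) (h2 : r0 / 2 < |y0|) (h3 : |y - y0| < |y0|) :
    gP θ (y / r) = gP θ (y0 / r0) := by
  unfold gP
  rw [abs_div, abs_div, abs_of_pos hr, abs_of_pos hr0,
    theta_big θ hθ _ (by rw [lt_div_iff₀ hr]; linarith),
    theta_big θ hθ _ (by rw [lt_div_iff₀ hr0]; linarith)]
  congr 2
  rcases lt_trichotomy y0 0 with h | h | h
  · rw [abs_of_neg h, abs_lt] at h3
    rw [Real.sign_of_neg (div_neg_of_neg_of_pos h hr0),
      Real.sign_of_neg (div_neg_of_neg_of_pos (by linarith) hr)]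
  · simp [h] at h2; linarith
  · rw [abs_of_pos h, abs_lt] at h3
    rw [Real.sign_of_pos (div_pos h hr0), Real.sign_of_pos (div_pos (by linarith) hr)]

lemma uD_eq {n : ℕ} (θ : ℝ → ℝ) (xb : Euc n) (hx : 0 < ‖xb‖) (t : ℝ) :
    uD θ (snocC xb t) = gP θ (t / ‖xb‖) := by
  have hf : frontC (snocC xb t) = xb := by
    ext i; simp [frontC, snocC]
  have hl : lastC (snocC xb t) = t := by simp [lastC, snocC]
  unfold uD
  rw [hf, hl, if_neg (norm_pos_iff.1 hx), gP, abs_div, abs_of_pos hx]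
  congr 2
  rcases lt_trichotomy t 0 with h | h | h
  · rw [Real.sign_of_neg h, Real.sign_of_neg (div_neg_of_neg_of_pos h hx)]
  · simp [h]
  · rw [Real.sign_of_pos h, Real.sign_of_pos (div_pos h hx)]

lemma u_repr {n : ℕ} (l : ℕ → ℝ) (h0 : ∀ j, 0 < l j) (h2 : ∀ j, 2 * l (j + 1) < l j)
    (θ : ℝ → ℝ) (hθ : IsProfile θ) (u : Euc (n + 1) → ℝ)
    (hu : ∀ x : Euc (n + 1),
      u x = ∫ t : ℝ, uD θ (snocC (frontC x) (lastC x - t)) ∂(gCantorMeasure l))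
    (x : Euc (n + 1)) (hx : 0 < ‖frontC x‖) :
    Integrable (fun τ => gP θ ((lastC x - gCantorPoint l (binDigit τ)) / ‖frontC x‖))
      (volume.restrict (Ico (0:ℝ) 1)) ∧
    u x = ∫ τ in Ico (0:ℝ) 1, gP θ ((lastC x - gCantorPoint l (binDigit τ)) / ‖frontC x‖) := by
  have hm : AEMeasurable (fun t => gCantorPoint l (binDigit t)) (volume.restrict (Ico (0:ℝ) 1)) :=
    aemeasurable_restrict_of_monotoneOn measurableSet_Ico (X_mono l h0 h2)
  have hc : Continuous (fun t => gP θ ((lastC x - t) / ‖frontC x‖)) := by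
    have := (gP_lip θ hθ).continuous
    fun_prop
  constructor
  · have : IsFiniteMeasure (volume.restrict (Ico (0:ℝ) 1)) := ⟨by simp⟩
    refine Integrable.of_bound (C := 1) ?_ (Eventually.of_forall fun τ => ?_)
    · exact (hc.measurable.comp_aemeasurable hm).aestronglyMeasurable
    · exact gP_bound θ hθ _
  · rw [hu]
    simp only [uD_eq θ _ hx]
    unfold gCantorMeasure
    rw [integral_map hm hc.aestronglyMeasurable]

lemma front_sub {n : ℕ} (x y : Euc (n + 1)) : |‖frontC x‖ - ‖frontC y‖| ≤ ‖x - y‖ := by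
  refine (abs_norm_sub_norm_le _ _).trans ?_
  rw [EuclideanSpace.norm_eq, EuclideanSpace.norm_eq]
  refine Real.sqrt_le_sqrt ?_
  rw [Fin.sum_univ_castSucc]
  simp only [frontC, PiLp.sub_apply]
  have : 0 ≤ ‖x (Fin.last n) - y (Fin.last n)‖ ^ 2 := by positivity
  linarith

lemma last_sub {n : ℕ} (x y : Euc (n + 1)) : |lastC x - lastC y| ≤ ‖x - y‖ := by
  have := PiLp.norm_apply_le (x - y) (Fin.last n)
  simpa [lastC] using this

lemma grad_zero {n : ℕ} (l : ℕ → ℝ) (h0 : ∀ j, 0 < l j) (h2 : ∀ j, 2 * l (j + 1) < l j)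
    (θ : ℝ → ℝ) (hθ : IsProfile θ) (u : Euc (n + 1) → ℝ)
    (hu : ∀ x : Euc (n + 1),
      u x = ∫ t : ℝ, uD θ (snocC (frontC x) (lastC x - t)) ∂(gCantorMeasure l))
    (x : Euc (n + 1)) (hx : 0 < ‖frontC x‖)
    (hd : ‖frontC x‖ / 2 < infDist (lastC x) (gCantorSet l)) : fderiv ℝ u x = 0 := by
  set m := infDist (lastC x) (gCantorSet l) with hm
  set r := ‖frontC x‖ with hr
  have he : u =ᶠ[𝓝 x] fun _ => u x := by
    have hε : 0 < min ((2 * m - r) / 3) (min (m / 2) (r / 2)) := by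
      refine lt_min (by linarith) (lt_min (by linarith) (by linarith))
    filter_upwards [Metric.ball_mem_nhds x hε] with y hy
    rw [Metric.mem_ball, dist_eq_norm, lt_min_iff, lt_min_iff] at hy
    have hf := abs_le.1 (front_sub y x)
    have hl' := last_sub y x
    rw [← hr] at hf
    have hy0 : 0 < ‖frontC y‖ := by linarith [hy.2.2]
    rw [(u_repr l h0 h2 θ hθ u hu y hy0).2, (u_repr l h0 h2 θ hθ u hu x hx).2]
    congr 1
    ext τ
    set c := gCantorPoint l (binDigit τ)
    have hmc : m ≤ |lastC x - c| := by
      rw [← Real.dist_eq]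
      exact Metric.infDist_le_dist_of_mem ⟨_, rfl⟩
    have h4 : |lastC y - c - (lastC x - c)| ≤ ‖y - x‖ := by
      rw [sub_sub_sub_cancel_right]; exact hl'
    have h5 : |lastC x - c| - ‖y - x‖ ≤ |lastC y - c| := by
      have := abs_sub_abs_le_abs_sub (lastC x - c) (lastC y - c)
      rw [abs_sub_comm] at h4
      linarith
    refine gP_far θ hθ _ _ _ _ hy0 hx ?_ ?_ ?_
    · linarith [hy.1]
    · linarith
    · linarith [hy.2.1]
  rw [he.fderiv_eq]
  simp

lemma grad_bound {n : ℕ} (l : ℕ → ℝ) (h0 : ∀ j, 0 < l j) (h2 : ∀ j, 2 * l (j + 1) < l j)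
    (θ : ℝ → ℝ) (hθ : IsProfile θ) (u : Euc (n + 1) → ℝ)
    (hu : ∀ x : Euc (n + 1),
      u x = ∫ t : ℝ, uD θ (snocC (frontC x) (lastC x - t)) ∂(gCantorMeasure l))
    (x : Euc (n + 1)) (hx : 0 < ‖frontC x‖) (M : ℝ) (hM : 0 ≤ M)
    (hd : volume {t : ℝ | t ∈ Ico (0:ℝ) 1 ∧
      |lastC x - gCantorPoint l (binDigit t)| ≤ ‖frontC x‖} ≤ ENNReal.ofReal M) :
    ‖fderiv ℝ u x‖ ≤ 9 / ‖frontC x‖ * M := by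
  set r := ‖frontC x‖ with hr
  set E := {t : ℝ | t ∈ Ico (0:ℝ) 1 ∧ |lastC x - gCantorPoint l (binDigit t)| ≤ r} with hE
  refine norm_fderiv_le_of_lip' ℝ (by positivity) ?_
  filter_upwards [Metric.ball_mem_nhds x (show 0 < r / 8 by positivity)] with y hy
  rw [Metric.mem_ball, dist_eq_norm] at hy
  have hf := front_sub y x
  rw [← hr] at hf
  have hf' := abs_le.1 hf
  have hl' := last_sub y x
  have hy0 : 0 < ‖frontC y‖ := by linarith
  obtain ⟨i1, e1⟩ := u_repr l h0 h2 θ hθ u hu y hy0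
  obtain ⟨i2, e2⟩ := u_repr l h0 h2 θ hθ u hu x hx
  rw [e1, e2, ← integral_sub i1 i2]
  have hmE : MeasurableSet (toMeasurable volume E) := measurableSet_toMeasurable _ _
  have hvE : volume (toMeasurable volume E) ≤ ENNReal.ofReal M := by
    rw [measure_toMeasurable]; exact hd
  have hvE' : (volume.restrict (Ico (0:ℝ) 1)) (toMeasurable volume E) ≤ ENNReal.ofReal M :=
    (Measure.restrict_le_self _).trans hvE
  calc _ ≤ ∫ τ in Ico (0:ℝ) 1, (toMeasurable volume E).indicator (fun _ => 9 / r * ‖y - x‖) τ := by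
        refine norm_integral_le_of_norm_le ?_ ?_
        · refine (integrable_indicator_iff hmE).2 ?_
          exact integrableOn_const (hvE'.trans_lt ENNReal.ofReal_lt_top).ne
        · refine (ae_restrict_iff' measurableSet_Ico).2 (Eventually.of_forall fun τ hτ => ?_)
          set c := gCantorPoint l (binDigit τ) with hc
          by_cases hin : |lastC x - c| ≤ r
          · rw [indicator_of_mem (subset_toMeasurable volume E (show τ ∈ E from ⟨hτ, hin⟩))]
            rw [Real.norm_eq_abs]
            refine (gP_dist θ hθ _ _).trans ?_
            set R := ‖frontC y‖
            have hR : 7 / 8 * r ≤ R := by linarith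
            have heq : (lastC y - c) / R - (lastC x - c) / r =
                ((lastC y - lastC x) * r + (lastC x - c) * (r - R)) / (R * r) := by
              field_simp; ring
            rw [heq, abs_div, abs_of_pos (mul_pos hy0 hx)]
            have hnum : |(lastC y - lastC x) * r + (lastC x - c) * (r - R)| ≤ 2 * r * ‖y - x‖ := by
              refine (abs_add_le _ _).trans ?_
              rw [abs_mul, abs_mul, abs_of_pos hx, abs_sub_comm r R]
              have : |lastC x - c| * |R - r| ≤ r * ‖y - x‖ := by gcongr
              nlinarith
            rw [← mul_div_assoc, div_mul_eq_mul_div, div_le_div_iff₀ (mul_pos hy0 hx) hx]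
            have hn0 := norm_nonneg (y - x)
            have : r * r * ‖y - x‖ * (7/8) ≤ R * r * ‖y - x‖ := by
              have : 0 ≤ r * ‖y - x‖ := by positivity
              nlinarith
            nlinarith
          · push Not at hin
            have h4 : |lastC y - c - (lastC x - c)| ≤ ‖y - x‖ := by
              rw [sub_sub_sub_cancel_right]; exact hl'
            have h5 : |lastC x - c| - ‖y - x‖ ≤ |lastC y - c| := by
              have := abs_sub_abs_le_abs_sub (lastC x - c) (lastC y - c)
              rw [abs_sub_comm] at h4
              linarith
            rw [gP_far θ hθ (lastC y - c) (lastC x - c) _ _ hy0 hx (by linarith) (by linarith)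
              (by linarith)]
            rw [sub_self, norm_zero]
            exact indicator_nonneg (fun _ _ => by positivity) _
    _ = ((volume.restrict (Ico (0:ℝ) 1)).real (toMeasurable volume E)) * (9 / r * ‖y - x‖) := by
        rw [integral_indicator_const _ hmE, smul_eq_mul]
    _ ≤ M * (9 / r * ‖y - x‖) := by
        gcongr
        exact ENNReal.toReal_le_of_le_ofReal hM hvE'
    _ = _ := by ring

end helpers3

section helpers4

lemma summ_base (lam E e : ℝ) (hl0 : 0 < lam) (hl1 : lam < 1)
    (h : 0 < E ∨ (E = 0 ∧ e < -1)) :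
    Summable fun j : ℕ => lam ^ (E * j) * (j : ℝ) ^ e := by
  rcases h with h | ⟨h, he⟩
  · obtain ⟨k, hk⟩ := exists_nat_ge e
    have hr0 : 0 < lam ^ E := Real.rpow_pos_of_pos hl0 E
    have hr : ‖lam ^ E‖ < 1 := by
      rw [Real.norm_of_nonneg hr0.le]
      exact Real.rpow_lt_one hl0.le hl1 h
    have := summable_pow_mul_geometric_of_norm_lt_one k hr
    refine Summable.of_norm_bounded_eventually_nat this ?_
    filter_upwards [eventually_ge_atTop 1] with j hj
    have hj' : (1:ℝ) ≤ j := by exact_mod_cast hj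
    rw [Real.norm_of_nonneg (by positivity), Real.rpow_mul hl0.le, Real.rpow_natCast, mul_comm]
    gcongr
    calc (j:ℝ) ^ e ≤ (j:ℝ) ^ (k:ℝ) := Real.rpow_le_rpow_of_exponent_le hj' hk
      _ = _ := Real.rpow_natCast _ _
  · subst h
    simpa using Real.summable_nat_rpow.2 he

lemma summ_main (lam gam D : ℝ) (hD : 0 < D) (hlam : lam = 2 ^ (-1 / D)) (l : ℕ → ℝ)
    (hl0 : ∀ j, 0 < l j) (C : ℝ) (hC : 1 ≤ C)
    (hb : ∀ j : ℕ, 1 ≤ j →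
      C⁻¹ * lam ^ j * (j : ℝ) ^ gam ≤ l j ∧ l j ≤ C * lam ^ j * (j : ℝ) ^ gam)
    (β τ : ℝ) (hβ : 0 ≤ β) (N : ℕ)
    (h : 0 < N - β + D * τ ∨ (N - β + D * τ = 0 ∧ gam * (N - β) < -1)) :
    Summable fun j : ℕ => l (j + 1) ^ (-β) * l j ^ N * (2:ℝ) ^ (-τ * j) := by
  have h0 : 0 < lam := by rw [hlam]; positivity
  have h1 : lam < 1 := by
    rw [hlam]
    refine Real.rpow_lt_one_of_one_lt_of_neg (by norm_num) ?_
    exact div_neg_of_neg_of_pos (by norm_num) hD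
  have h2 : (2:ℝ) = lam ^ (-D) := by
    rw [hlam, ← Real.rpow_mul (by norm_num)]
    rw [show -1 / D * -D = 1 by field_simp]; simp
  have hC0 : 0 < C := by linarith
  have hS := (summ_base lam _ _ h0 h1 h).mul_left
    (C ^ β * lam ^ (-β) * 2 ^ |gam * β| * C ^ N)
  refine Summable.of_norm_bounded_eventually_nat hS ?_
  filter_upwards [eventually_ge_atTop 1] with j hj
  have hj' : (1:ℝ) ≤ j := by exact_mod_cast hj
  have hj0 : (0:ℝ) < j := by linarith
  have e1 : l (j + 1) ^ (-β) ≤ C ^ β * lam ^ (-β * (j + 1)) * (2 ^ |gam * β| * (j:ℝ) ^ (-(gam * β))) := by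
    have hb1 := (hb (j + 1) (by omega)).1
    push_cast at hb1
    calc l (j + 1) ^ (-β) ≤ (C⁻¹ * lam ^ (j + 1) * ((j:ℝ) + 1) ^ gam) ^ (-β) :=
          Real.rpow_le_rpow_of_nonpos (by positivity) hb1 (by linarith)
      _ = C ^ β * lam ^ (-β * (j + 1)) * ((j:ℝ) + 1) ^ (-(gam * β)) := by
          rw [Real.mul_rpow (by positivity) (by positivity),
            Real.mul_rpow (by positivity) (by positivity), Real.inv_rpow hC0.le,
            Real.rpow_neg hC0.le, inv_inv, ← Real.rpow_natCast lam, ← Real.rpow_mul h0.le,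
            ← Real.rpow_mul (by positivity)]
          push_cast
          congr 2
          · congr 1; ring_nf
          · ring
      _ ≤ _ := by
          gcongr
          have hq : ((j:ℝ) + 1) = ((j + 1) / j) * j := by field_simp
          have hq1 : (1:ℝ) ≤ ((j:ℝ) + 1) / j := by rw [le_div_iff₀ hj0]; linarith
          have hq2 : ((j:ℝ) + 1) / j ≤ 2 := by rw [div_le_iff₀ hj0]; linarith
          rw [show ((j:ℝ) + 1) ^ (-(gam * β)) = (((j:ℝ) + 1) / j) ^ (-(gam * β)) * (j:ℝ) ^ (-(gam * β)) by
            rw [← Real.mul_rpow (by positivity) hj0.le, ← hq]]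
          gcongr
          calc (((j:ℝ) + 1) / j) ^ (-(gam * β)) ≤ (((j:ℝ) + 1) / j) ^ |gam * β| :=
                Real.rpow_le_rpow_of_exponent_le hq1 (neg_le_abs _)
            _ ≤ 2 ^ |gam * β| := Real.rpow_le_rpow (by positivity) hq2 (abs_nonneg _)
  have e2 : l j ^ N ≤ C ^ N * lam ^ ((j:ℝ) * N) * (j:ℝ) ^ (gam * N) := by
    calc l j ^ N ≤ (C * lam ^ j * (j : ℝ) ^ gam) ^ N := by
          have := (hb j hj).2
          have := (hl0 j).le
          gcongr
      _ = _ := by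
          rw [mul_pow, mul_pow, Real.rpow_mul h0.le, Real.rpow_natCast, Real.rpow_natCast,
            Real.rpow_mul hj0.le, Real.rpow_natCast]
  have e3 : (2:ℝ) ^ (-τ * j) = lam ^ (D * τ * j) := by
    nth_rw 1 [h2]
    rw [← Real.rpow_mul h0.le]; congr 1; ring
  have p1 := hl0 (j + 1)
  have p2 := hl0 j
  rw [Real.norm_of_nonneg (by positivity), e3]
  calc _ ≤ (C ^ β * lam ^ (-β * (j + 1)) * (2 ^ |gam * β| * (j:ℝ) ^ (-(gam * β)))) *
        (C ^ N * lam ^ ((j:ℝ) * N) * (j:ℝ) ^ (gam * N)) * lam ^ (D * τ * j) := by gcongr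
    _ = (C ^ β * 2 ^ |gam * β| * C ^ N) *
        (lam ^ (-β * (j + 1)) * lam ^ ((j:ℝ) * N) * lam ^ (D * τ * j)) *
        ((j:ℝ) ^ (-(gam * β)) * (j:ℝ) ^ (gam * N)) := by ring
    _ = (C ^ β * 2 ^ |gam * β| * C ^ N) * (lam ^ (-β) * lam ^ ((N - β + D * τ) * j)) *
        ((j:ℝ) ^ (gam * (N - β))) := by
        rw [← Real.rpow_add h0, ← Real.rpow_add h0, ← Real.rpow_add h0, ← Real.rpow_add hj0]
        congr 3 <;> ring
    _ = _ := by ring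

lemma conj_bound (p q A s : ℝ) (hp : 1 < p) (hq : 1 < q) (hA : 0 < A) (hs : 0 ≤ s) :
    conjOrlicz (fun t => t ^ p / p + A * t ^ q / q) s ≤
      ENNReal.ofReal (s ^ (q / (q - 1)) * A ^ (-1 / (q - 1))) := by
  refine iSup_le fun t => ENNReal.ofReal_le_ofReal ?_
  have ht : (0:ℝ) ≤ t := t.2
  have hpq : Real.HolderConjugate (q / (q - 1)) q := (Real.HolderConjugate.conjExponent hq).symm
  have hy := Real.young_inequality_of_nonneg (a := s * A ^ (-1 / q)) (b := A ^ (1 / q) * t)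
    (by positivity) (by positivity) hpq
  have hq0 : 0 < q := by linarith
  have hq1 : 0 < q - 1 := by linarith
  have e1 : s * A ^ (-1 / q) * (A ^ (1 / q) * t) = s * t := by
    have : A ^ (-1 / q) * A ^ (1 / q) = 1 := by
      rw [← Real.rpow_add hA, show -1 / q + 1 / q = 0 by ring, Real.rpow_zero]
    linear_combination s * t * this
  have e2 : (s * A ^ (-1 / q)) ^ (q / (q - 1)) = s ^ (q / (q - 1)) * A ^ (-1 / (q - 1)) := by
    rw [Real.mul_rpow hs (by positivity), ← Real.rpow_mul hA.le]
    congr 2; field_simp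
  have e3 : (A ^ (1 / q) * (t:ℝ)) ^ q = A * (t:ℝ) ^ q := by
    rw [Real.mul_rpow (by positivity) ht, ← Real.rpow_mul hA.le,
      show 1 / q * q = 1 by field_simp, Real.rpow_one]
  rw [e1, e2, e3] at hy
  have e4 : s ^ (q / (q - 1)) * A ^ (-1 / (q - 1)) / (q / (q - 1)) ≤
      s ^ (q / (q - 1)) * A ^ (-1 / (q - 1)) := by
    refine div_le_self (by positivity) ?_
    rw [le_div_iff₀ hq1]; linarith
  have e5 : 0 ≤ (t:ℝ) ^ p / p := by positivity
  linarith

lemma conj_zero (p q A : ℝ) (hp : 1 < p) (hq : 1 < q) (hA : 0 ≤ A) :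
    conjOrlicz (fun t => t ^ p / p + A * t ^ q / q) 0 = 0 := by
  refine le_antisymm (iSup_le fun t => ?_) zero_le
  rw [ENNReal.ofReal_of_nonpos]
  have ht : (0:ℝ) ≤ t := t.2
  have : 0 ≤ (t:ℝ) ^ p / p + A * (t:ℝ) ^ q / q := by positivity
  linarith

lemma choose_eta (p q κ k1 k2 : ℝ) (hp : 1 < p) (hpq : p < q) (hκ : 0 < κ) :
    ∃ η s : ℝ, 0 < η ∧ 0 < s ∧ η ^ p * k1 + s ^ (q / (q - 1)) * k2 < κ * η * s := by
  set m := (p + q) / 2 with hm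
  have hq1 : 0 < q - 1 := by linarith
  have t1 : Tendsto (fun η : ℝ => η ^ (-(m - p)) * k1) atTop (𝓝 0) := by
    simpa using (tendsto_rpow_neg_atTop (show 0 < m - p by linarith)).mul_const k1
  have t2 : Tendsto (fun η : ℝ => η ^ (-((q - m) / (q - 1))) * k2) atTop (𝓝 0) := by
    simpa using (tendsto_rpow_neg_atTop
      (show 0 < (q - m) / (q - 1) from div_pos (by linarith) hq1)).mul_const k2
  have t3 := t1.add t2
  rw [add_zero] at t3
  obtain ⟨η, hη, hη1⟩ := ((t3.eventually (gt_mem_nhds hκ)).and (eventually_ge_atTop 1)).exists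
  have h0 : 0 < η := by linarith
  refine ⟨η, η ^ (m - 1), h0, by positivity, ?_⟩
  have e0 : η * η ^ (m - 1) = η ^ m := by
    conv_lhs => rw [← Real.rpow_one η]
    rw [Real.rpow_one η, ← Real.rpow_one_add' h0.le (by linarith)]
    congr 1; ring
  have e1 : η ^ p = η ^ (-(m - p)) * η ^ m := by
    rw [← Real.rpow_add h0]; congr 1; ring
  have e2 : (η ^ (m - 1)) ^ (q / (q - 1)) = η ^ (-((q - m) / (q - 1))) * η ^ m := by
    rw [← Real.rpow_add h0, ← Real.rpow_mul h0.le]; congr 1; field_simp; ring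
  rw [mul_assoc, e0, e1, e2]
  have : 0 < η ^ m := by positivity
  nlinarith

end helpers4
/-- The superdimensional double phase model `φ(x,t) = t^p/p + a(x) t^q/q`
with weight `a(x) = |x̄|^α (1 − ρ_a(x))`, competitor `u = (μ_{λ,γ} * u_d)` and auxiliary
function `b = |x̄|^{1−d} 1_{2|x̄| ≤ dist(x_d,𝔠_{λ,γ}) ≤ 4|x̄|}` satisfies the main
assumption: if `q > p₀ + α(p₀−1)/(d−1)` and either `p < p₀`, or `p = p₀` and
`γ𝔇(p₀−1) > 1`, then `F(u) < ∞`, `F*(b) < ∞`, and for every `κ > 0` there are `η, s > 0`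
with `F(η u) + F*(s b) < κ η s` (here `d = n+1`, `𝔇 = (p₀−d)/(p₀−1)`, `λ = 2^{−1/𝔇}`). -/
theorem double_phase_super_main_assumption
    {n : ℕ} (hn : 1 ≤ n) (p₀ gam D lam : ℝ) (hp₀ : (n : ℝ) + 1 < p₀)
    (hD : D = (p₀ - ((n : ℝ) + 1)) / (p₀ - 1)) (hlam : lam = 2 ^ (-1 / D))
    (l : ℕ → ℝ) (hl : IsCantorLengths lam gam l)
    -- the competitor `u = (δ_0^{d−1} × μ_{λ,γ}) * u_d`
    (θ : ℝ → ℝ) (hθ : IsProfile θ)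
    (u : Euc (n + 1) → ℝ)
    (hu : ∀ x : Euc (n + 1),
      u x = ∫ t : ℝ, uD θ (snocC (frontC x) (lastC x - t)) ∂(gCantorMeasure l))
    -- the auxiliary function `b`
    (b : Euc (n + 1) → ℝ)
    (hb : ∀ x : Euc (n + 1), b x =
      ‖frontC x‖ ^ (1 - ((n : ℝ) + 1)) *
        (if 2 * ‖frontC x‖ ≤ Metric.infDist (lastC x) (gCantorSet l) ∧
            Metric.infDist (lastC x) (gCantorSet l) ≤ 4 * ‖frontC x‖ then 1 else 0))
    -- the cut-off `ρ_a` and the weight `a(x) = |x̄|^α (1 − ρ_a(x))`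
    (α p q : ℝ) (hα : 0 < α) (hp1 : 1 < p) (hpq : p < q)
    (ρa : Euc (n + 1) → ℝ)
    (hρasmooth : ContDiffOn ℝ (⊤ : ℕ∞) ρa
      {x : Euc (n + 1) | frontC x = 0 ∧ lastC x ∈ gCantorSet l}ᶜ)
    (hρa1 : ∀ x : Euc (n + 1),
      (if Metric.infDist (lastC x) (gCantorSet l) ≤ ‖frontC x‖ / 2 then (1 : ℝ) else 0)
        ≤ ρa x)
    (hρa2 : ∀ x : Euc (n + 1),
      ρa x ≤ if Metric.infDist (lastC x) (gCantorSet l) ≤ 2 * ‖frontC x‖ then 1 else 0)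
    (hρa3 : ∃ C : ℝ, 0 < C ∧ ∀ x : Euc (n + 1),
      ¬(frontC x = 0 ∧ lastC x ∈ gCantorSet l) →
      ‖fderiv ℝ ρa x‖ ≤ C * ‖frontC x‖⁻¹ *
        (if ‖frontC x‖ / 2 ≤ Metric.infDist (lastC x) (gCantorSet l) ∧
            Metric.infDist (lastC x) (gCantorSet l) ≤ 2 * ‖frontC x‖ then 1 else 0))
    (a : Euc (n + 1) → ℝ) (ha : ∀ x, a x = ‖frontC x‖ ^ α * (1 - ρa x))
    (hq : p₀ + α * (p₀ - 1) / (n : ℝ) < q)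
    (hcase : p < p₀ ∨ (p = p₀ ∧ 1 < gam * D * (p₀ - 1))) :
    energyOf (Box (n + 1)) (fun x t => t ^ p / p + a x * t ^ q / q)
      (fun x => ‖fderiv ℝ u x‖) < ⊤ ∧
    energyConj (Box (n + 1)) (fun x t => t ^ p / p + a x * t ^ q / q)
      (fun x => |b x|) < ⊤ ∧
    ∀ κ : ℝ, 0 < κ → ∃ η s : ℝ, 0 < η ∧ 0 < s ∧
      energyOf (Box (n + 1)) (fun x t => t ^ p / p + a x * t ^ q / q)
          (fun x => η * ‖fderiv ℝ u x‖) +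
        energyConj (Box (n + 1)) (fun x t => t ^ p / p + a x * t ^ q / q)
          (fun x => s * |b x|) < ENNReal.ofReal (κ * η * s) := by
  obtain ⟨h00, h0, h2, -, C, hC, hlb⟩ := hl
  have hn' : (1:ℝ) ≤ n := by exact_mod_cast hn
  have hn0 : (0:ℝ) < n := by linarith
  have hp01 : 0 < p₀ - 1 := by linarith
  have hq1 : 1 < q := by linarith
  have hp0 : 0 < p := by linarith
  have hq0 : 0 < q := by linarith
  have hDpos : 0 < D := by rw [hD]; exact div_pos (by linarith) hp01
  have hDe : D * (p₀ - 1) = p₀ - (n + 1) := by rw [hD]; field_simp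
  have hD1 : (1 - D) * (p₀ - 1) = n := by linarith
  have hD2 : 0 < 1 - D := by
    by_contra hc
    push Not at hc
    nlinarith
  -- properties of the weight
  have hρle : ∀ x, ρa x ≤ 1 := fun x => (hρa2 x).trans (by split_ifs <;> norm_num)
  have ha0 : ∀ x, 0 ≤ a x := by
    intro x
    rw [ha]
    exact mul_nonneg (by positivity) (by linarith [hρle x])
  have haz : ∀ x, infDist (lastC x) (gCantorSet l) ≤ ‖frontC x‖ / 2 → a x = 0 := by
    intro x hx
    have := hρa1 x
    rw [if_pos hx] at this
    rw [ha, le_antisymm (hρle x) this]; simp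
  have hab : ∀ x, 0 < ‖frontC x‖ → 2 * ‖frontC x‖ ≤ infDist (lastC x) (gCantorSet l) →
      a x = ‖frontC x‖ ^ α := by
    intro x hx hd
    have hge : 0 ≤ ρa x := le_trans (by split_ifs <;> norm_num) (hρa1 x)
    have hle : ρa x ≤ 0 := by
      have hcont : ContinuousAt ρa x := by
        refine ContinuousOn.continuousAt (hρasmooth.continuousOn) ?_
        have hfc : Continuous (fun y : Euc (n + 1) => ‖frontC y‖) := by
          refine continuous_iff_continuousAt.2 fun y => ?_
          refine tendsto_iff_dist_tendsto_zero.2 ?_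
          have ht : Tendsto (fun z : Euc (n+1) => ‖z - y‖) (𝓝 y) (𝓝 0) :=
            tendsto_iff_norm_sub_tendsto_zero.1 tendsto_id
          exact squeeze_zero (fun z => dist_nonneg) (fun z => front_sub z y) ht
        have : {y : Euc (n + 1) | 0 < ‖frontC y‖} ∈ 𝓝 x :=
          (isOpen_lt continuous_const hfc).mem_nhds hx
        filter_upwards [this] with y hy
        rintro ⟨h1, -⟩
        have hy' : 0 < ‖frontC y‖ := hy
        rw [h1] at hy'
        simp at hy'
      let w : ℝ → Euc (n + 1) := fun ε => snocC ((1 - ε) • frontC x) (lastC x)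
      have hw0 : w 0 = x := by
        ext i
        refine Fin.lastCases ?_ (fun i => ?_) i
        · simp [w, snocC, lastC]
        · simp [w, snocC, frontC]
      have hwc : Continuous w := by
        refine (PiLp.continuous_toLp 2 _).comp ?_
        refine continuous_pi fun i => ?_
        refine Fin.lastCases ?_ (fun i => ?_) i
        · simp only [Fin.snoc_last]; exact continuous_const
        · simp only [Fin.snoc_castSucc, PiLp.smul_apply, smul_eq_mul]; fun_prop
      have ht : Tendsto (fun ε => ρa (w ε)) (𝓝[>] 0) (𝓝 (ρa x)) := by
        have : Tendsto w (𝓝[>] 0) (𝓝 x) := by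
          have := (hwc.tendsto 0).mono_left (nhdsWithin_le_nhds (s := Ioi 0))
          rwa [hw0] at this
        exact hcont.tendsto.comp this
      refine le_of_tendsto ht ?_
      filter_upwards [Ioo_mem_nhdsGT (show (0:ℝ) < 1 by norm_num)] with ε hε
      have hf : frontC (w ε) = (1 - ε) • frontC x := by
        ext i; simp [w, frontC, snocC]
      have hl : lastC (w ε) = lastC x := by simp [w, lastC, snocC]
      have := hρa2 (w ε)
      rw [hf, hl, norm_smul, Real.norm_of_nonneg (by linarith [hε.2]), if_neg] at this
      · exact this
      · push Not
        have := hε.1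
        nlinarith
    rw [ha, le_antisymm hle hge]; simp
  -- gradient energy
  set g : Euc (n + 1) → ℝ := fun x => ‖fderiv ℝ u x‖ with hg
  have hgz : ∀ x, 0 < ‖frontC x‖ → ‖frontC x‖ / 2 < infDist (lastC x) (gCantorSet l) → g x = 0 := by
    intro x hx hd
    simp only [hg]
    rw [grad_zero l h0 h2 θ hθ u hu x hx hd, norm_zero]
  have hK1 : ∫⁻ x in Box (n + 1), ENNReal.ofReal (g x ^ p / p) < ⊤ := by
    refine shell_bound hn l h00 h0 h2 _ (ENNReal.ofReal (9 ^ p / p)) ENNReal.ofReal_ne_top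
      (fun j => (9 / l (j + 1) * (4 * (1/2) ^ j)) ^ p / p) ?_ ?_ ?_ ?_ ?_
    · intro j
      have := h0 (j + 1)
      positivity
    · intro x hx
      refine ENNReal.ofReal_le_ofReal ?_
      have hx0 : 0 < ‖frontC x‖ := by linarith
      have hb1 := grad_bound l h0 h2 θ hθ u hu x hx0 1 zero_le_one (by
        refine (measure_mono (t := Ico (0:ℝ) 1) (fun t ht => ht.1)).trans ?_
        simp)
      have hb2 : g x ≤ 9 := by
        refine hb1.trans ?_
        rw [mul_one, div_le_iff₀ hx0]; linarith
      have : 0 ≤ g x := norm_nonneg _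
      gcongr
    · intro x j hj1 hj2 _
      refine ENNReal.ofReal_le_ofReal ?_
      have hx0 : 0 < ‖frontC x‖ := (h0 _).trans_le hj1
      have hb1 := grad_bound l h0 h2 θ hθ u hu x hx0 (4 * (1/2)^j) (by positivity)
        (vol_E l h0 h2 _ _ j hj2.le)
      have hb2 : g x ≤ 9 / l (j + 1) * (4 * (1/2) ^ j) := by
        refine hb1.trans ?_
        have := h0 (j + 1)
        gcongr
      have : 0 ≤ g x := norm_nonneg _
      gcongr
    · intro x hx hd
      rw [hgz x hx (by linarith), Real.zero_rpow hp0.ne']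
      simp
    · have hS := (summ_main lam gam D hDpos hlam l h0 C hC hlb p (p - 1) hp0.le (n + 1) (by
        push_cast
        rcases hcase with hc | ⟨hc, hgm⟩
        · left
          have : 0 < (1 - D) * (p₀ - p) := mul_pos hD2 (by linarith)
          nlinarith
        · right
          subst hc
          constructor
          · linarith
          · have : gam * (n + 1 - p) = -(gam * D * (p - 1)) := by
              linear_combination gam * hDe
            linarith)).mul_left (36 ^ p / p)
      convert! hS using 2 with j
      have := h0 (j + 1)
      have e1 : (9 / l (j + 1) * (4 * (1/2) ^ j)) ^ p
          = 36 ^ p * l (j + 1) ^ (-p) * (2:ℝ) ^ (-p * j) := by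
        rw [show 9 / l (j + 1) * (4 * (1/2:ℝ) ^ j) = 36 * (l (j + 1))⁻¹ * (2:ℝ) ^ (-(j:ℝ)) by
          rw [Real.rpow_neg (by norm_num), Real.rpow_natCast, one_div, inv_pow]; ring]
        rw [Real.mul_rpow (by positivity) (by positivity),
          Real.mul_rpow (by positivity) (by positivity), ← Real.rpow_mul (by norm_num),
          Real.inv_rpow this.le, Real.rpow_neg this.le]
        congr 2; ring
      have e2 : (2:ℝ) ^ (-(p - 1) * j) = (2:ℝ) ^ (-p * j) * 2 ^ j := by
        rw [← Real.rpow_natCast, ← Real.rpow_add (by norm_num)]; congr 1; ring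
      rw [e1, e2]; ring
  have hen : ∀ η : ℝ, 0 < η →
      energyOf (Box (n + 1)) (fun x t => t ^ p / p + a x * t ^ q / q) (fun x => η * g x) ≤
        ENNReal.ofReal (η ^ p) * ∫⁻ x in Box (n + 1), ENNReal.ofReal (g x ^ p / p) := by
    intro η hη
    unfold energyOf
    rw [← lintegral_const_mul' _ _ ENNReal.ofReal_ne_top]
    refine lintegral_mono_ae (ae_restrict_of_ae ?_)
    filter_upwards [front_null hn] with x hx
    rw [← ENNReal.ofReal_mul (by positivity)]
    refine ENNReal.ofReal_le_ofReal ?_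
    have hg0 : 0 ≤ g x := norm_nonneg _
    have hz : a x * (η * g x) ^ q / q = 0 := by
      by_cases hd : infDist (lastC x) (gCantorSet l) ≤ ‖frontC x‖ / 2
      · rw [haz x hd]; simp
      · rw [hgz x hx (not_le.1 hd), mul_zero, Real.zero_rpow hq0.ne']; simp
    rw [hz, Real.mul_rpow hη.le hg0]
    exact le_of_eq (by ring)
  -- conjugate energy
  set β : ℝ := (n * q + α) / (q - 1) with hβ
  have hq10 : 0 < q - 1 := by linarith
  have hβ0 : 0 < β := div_pos (by positivity) hq10
  set G : Euc (n + 1) → ℝ≥0∞ := fun x => if 0 < ‖frontC x‖ ∧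
    2 * ‖frontC x‖ ≤ infDist (lastC x) (gCantorSet l) ∧
      infDist (lastC x) (gCantorSet l) ≤ 4 * ‖frontC x‖
      then ENNReal.ofReal (‖frontC x‖ ^ (-β)) else 0 with hG
  have hK2 : ∫⁻ x in Box (n + 1), G x < ⊤ := by
    refine shell_bound hn l h00 h0 h2 _ 1 ENNReal.one_ne_top
      (fun j => l (j + 1) ^ (-β)) ?_ ?_ ?_ ?_ ?_
    · intro j
      have := h0 (j + 1)
      positivity
    · intro x hx
      simp only [hG]
      split_ifs
      · rw [← ENNReal.ofReal_one]
        exact ENNReal.ofReal_le_ofReal (Real.rpow_le_one_of_one_le_of_nonpos hx (by linarith))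
      · exact zero_le
    · intro x j hj1 hj2 _
      simp only [hG]
      split_ifs
      · exact ENNReal.ofReal_le_ofReal
          (Real.rpow_le_rpow_of_nonpos (h0 _) hj1 (by linarith))
      · exact zero_le
    · intro x hx hd
      simp only [hG]
      rw [if_neg]
      rintro ⟨-, -, h⟩
      linarith
    · have hS := summ_main lam gam D hDpos hlam l h0 C hC hlb β (-1) hβ0.le (n + 1) (by
        left
        push_cast
        have e : (n:ℝ) + 1 - β + D * (-1) = ((1 - D) * (q - 1) - (n + α)) / (q - 1) := by
          rw [hβ]; field_simp; ring
        rw [e]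
        refine div_pos ?_ hq10
        have e2 : (1 - D) = n / (p₀ - 1) := by rw [← hD1]; field_simp
        have h3 : (1 - D) * (p₀ - 1 + α * (p₀ - 1) / n) = n + α := by
          rw [e2]; field_simp
        nlinarith)
      convert! hS using 2 with j
      rw [neg_neg, one_mul, Real.rpow_natCast]
  have hbne : ∀ x s, 0 < s → conjOrlicz (fun t => t ^ p / p + a x * t ^ q / q) (s * |b x|) ≤
      ENNReal.ofReal (s ^ (q / (q - 1))) * G x := by
    intro x s hs
    by_cases hc : 0 < ‖frontC x‖ ∧
      2 * ‖frontC x‖ ≤ infDist (lastC x) (gCantorSet l) ∧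
      infDist (lastC x) (gCantorSet l) ≤ 4 * ‖frontC x‖
    · simp only [hG]
      rw [if_pos hc, hb x, if_pos hc.2, hab x hc.1 hc.2.1, mul_one]
      set r := ‖frontC x‖
      have hr : 0 < r := hc.1
      refine (conj_bound p q (r ^ α) _ hp1 hq1 (by positivity) (by positivity)).trans ?_
      rw [← ENNReal.ofReal_mul (by positivity)]
      refine ENNReal.ofReal_le_ofReal (le_of_eq ?_)
      rw [abs_of_pos (by positivity), Real.mul_rpow hs.le (by positivity),
        ← Real.rpow_mul hr.le, ← Real.rpow_mul hr.le, mul_assoc, ← Real.rpow_add hr]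
      congr 2
      rw [hβ]; field_simp; ring
    · have hb0 : b x = 0 := by
        rw [hb]
        by_cases hx : 0 < ‖frontC x‖
        · rw [if_neg (fun h => hc ⟨hx, h⟩), mul_zero]
        · have hx0 : ‖frontC x‖ = 0 := le_antisymm (not_lt.1 hx) (norm_nonneg _)
          rw [hx0, Real.zero_rpow (by linarith), zero_mul]
      rw [hb0, abs_zero, mul_zero, conj_zero p q _ hp1 hq1 (ha0 x)]
      exact zero_le
  have hec : ∀ s : ℝ, 0 < s →
      energyConj (Box (n + 1)) (fun x t => t ^ p / p + a x * t ^ q / q) (fun x => s * |b x|) ≤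
        ENNReal.ofReal (s ^ (q / (q - 1))) * ∫⁻ x in Box (n + 1), G x := by
    intro s hs
    unfold energyConj
    rw [← lintegral_const_mul' _ _ ENNReal.ofReal_ne_top]
    exact lintegral_mono fun x => hbne x s hs
  refine ⟨?_, ?_, ?_⟩
  · have := hen 1 one_pos
    simp only [one_mul] at this
    exact this.trans_lt (ENNReal.mul_lt_top ENNReal.ofReal_lt_top hK1)
  · have := hec 1 one_pos
    simp only [one_mul] at this
    exact this.trans_lt (ENNReal.mul_lt_top ENNReal.ofReal_lt_top hK2)
  · intro κ hκ
    set K1 := ∫⁻ x in Box (n + 1), ENNReal.ofReal (g x ^ p / p)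
    set K2 := ∫⁻ x in Box (n + 1), G x
    obtain ⟨η, s, hη, hs, hlt⟩ := choose_eta p q κ K1.toReal K2.toReal hp1 hpq hκ
    refine ⟨η, s, hη, hs, ?_⟩
    refine (add_le_add (hen η hη) (hec s hs)).trans_lt ?_
    rw [← ENNReal.ofReal_toReal hK1.ne, ← ENNReal.ofReal_toReal hK2.ne,
      ← ENNReal.ofReal_mul (by positivity), ← ENNReal.ofReal_mul (by positivity),
      ← ENNReal.ofReal_add (by positivity) (by positivity)]
    exact (ENNReal.ofReal_lt_ofReal_iff (by positivity)).2 hlt
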